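/- arXiv:0906.0895 — 2 statements merged into one kernel-verified Lean document; each statement's English description precedes it below -/
import Mathlib

section
/- Let G be a 3-γ-vertex-critical graph with a cut-vertex u. Then G − u has exactly two connected components; moreover, for each component C of G − u, the induced subgraph G[V(C) ∪ {u}] is 2-γ-vertex-critical. -/
open SimpleGraph

/-- `D` is a dominating set of `G`: every vertex is in `D` or adjacent to a vertex of `D`. -/
def IsDomSet {V : Type*} (G : SimpleGraph V) (D : Set V) : Prop :=
  ∀ v, v ∈ D ∨ ∃ u ∈ D, G.Adj u v

/-- The domination number `γ(G)`. -/
noncomputable def domNum {V : Type*} (G : SimpleGraph V) : ℕ :=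
  sInf {n | ∃ D : Set V, IsDomSet G D ∧ D.ncard = n}

/-- `D` is a dominating set of the vertex-deleted graph `G - x`. -/
def IsDomSetAvoiding {V : Type*} (G : SimpleGraph V) (x : V) (D : Set V) : Prop :=
  x ∉ D ∧ ∀ v, v ≠ x → v ∈ D ∨ ∃ u ∈ D, G.Adj u v

/-- The domination number of the vertex-deleted graph `G - x`. -/
noncomputable def domNumDel {V : Type*} (G : SimpleGraph V) (x : V) : ℕ :=
  sInf {n | ∃ D : Set V, IsDomSetAvoiding G x D ∧ D.ncard = n}

/-- `G` is `k`-`γ`-vertex-critical: `γ(G) = k` and `γ(G - v) < k` for every vertex `v`. -/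
def GammaCritical {V : Type*} (G : SimpleGraph V) (k : ℕ) : Prop :=
  domNum G = k ∧ ∀ v : V, domNumDel G v < k

/-- `G` is `K_{1,n}`-free: it has no induced subgraph isomorphic to the star `K_{1,n}`. -/
def StarFree {V : Type*} (G : SimpleGraph V) (n : ℕ) : Prop :=
  ¬ ∃ (c : V) (T : Finset V), T.card = n ∧ (∀ t ∈ T, G.Adj c t) ∧
      ∀ t ∈ T, ∀ t' ∈ T, t ≠ t' → ¬ G.Adj t t'

/-- `G` has a perfect matching. -/
def HasPerfectMatching {V : Type*} (G : SimpleGraph V) : Prop :=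
  ∃ M : G.Subgraph, M.IsPerfectMatching

/-- `G` has a near perfect matching: a matching covering all but exactly one vertex. -/
def HasNearPerfectMatching {V : Type*} (G : SimpleGraph V) : Prop :=
  ∃ (M : G.Subgraph) (v : V), M.IsMatching ∧ M.verts = {v}ᶜ

/-- `c_o(G - S)`: the number of odd components of `G - S`. -/
noncomputable def numOddComponents {V : Type*} (G : SimpleGraph V) (S : Set V) : ℕ :=
  Nat.card {c : (G.induce Sᶜ).ConnectedComponent // Odd c.supp.ncard}

theorem IsDomSet.mono {V : Type*} {G : SimpleGraph V} {D E : Set V} (hD : IsDomSet G D)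
    (h : D ⊆ E) : IsDomSet G E := fun v =>
  (hD v).imp (fun hv => h hv) fun ⟨w, hw, hwv⟩ => ⟨w, h hw, hwv⟩

theorem domNum_le_ncard {V : Type*} {G : SimpleGraph V} {D : Set V} (hD : IsDomSet G D) :
    domNum G ≤ D.ncard :=
  Nat.sInf_le ⟨D, hD, rfl⟩

theorem domNumDel_le_ncard {V : Type*} {G : SimpleGraph V} {x : V} {D : Set V}
    (hD : IsDomSetAvoiding G x D) : domNumDel G x ≤ D.ncard :=
  Nat.sInf_le ⟨D, hD, rfl⟩

theorem exists_isDomSet_ncard_eq_domNum {V : Type*} (G : SimpleGraph V) :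
    ∃ D : Set V, IsDomSet G D ∧ D.ncard = domNum G :=
  Nat.sInf_mem (s := {n | ∃ D : Set V, IsDomSet G D ∧ D.ncard = n})
    ⟨_, Set.univ, fun _ => Or.inl trivial, rfl⟩

theorem exists_isDomSetAvoiding_ncard_eq_domNumDel {V : Type*} (G : SimpleGraph V) (x : V) :
    ∃ D : Set V, IsDomSetAvoiding G x D ∧ D.ncard = domNumDel G x :=
  Nat.sInf_mem (s := {n | ∃ D : Set V, IsDomSetAvoiding G x D ∧ D.ncard = n})
    ⟨_, {x}ᶜ, ⟨by simp, fun _ hv => Or.inl hv⟩, rfl⟩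

theorem domNum_eq_two {V : Type*} [Finite V] {G : SimpleGraph V} {x y : V}
    (hxy : IsDomSet G {x, y}) (h : ∀ z, ¬ IsDomSet G {z}) : domNum G = 2 := by
  refine le_antisymm ((domNum_le_ncard hxy).trans (Set.ncard_insert_le _ _ |>.trans (by simp))) ?_
  obtain ⟨D, hD, hcard⟩ := exists_isDomSet_ncard_eq_domNum G
  by_contra hlt
  have : Nonempty V := ⟨x⟩
  obtain ⟨z, hz⟩ := (Set.ncard_le_one_iff_subset_singleton (s := D)).1 (by omega)
  exact h z (hD.mono hz)

theorem GammaCritical.not_isDomSet_pair {V : Type*} {G : SimpleGraph V} (h : GammaCritical G 3)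
    (a b : V) : ¬ IsDomSet G {a, b} := fun hD => by
  have h₁ := domNum_le_ncard hD
  have h₂ := Set.ncard_insert_le a {b}
  rw [Set.ncard_singleton] at h₂
  have h₃ := h.1
  omega

theorem GammaCritical.exists_isDomSetAvoiding_pair {V : Type*} [Finite V] {G : SimpleGraph V}
    (h : GammaCritical G 3) (v : V) : ∃ a b, IsDomSetAvoiding G v {a, b} := by
  obtain ⟨D, hD, hcard⟩ := exists_isDomSetAvoiding_ncard_eq_domNumDel G v
  have hlt := h.2 v
  have hcases : D.ncard = 0 ∨ D.ncard = 1 ∨ D.ncard = 2 := by omega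
  rcases hcases with h₀ | h₁ | h₂
  · rw [Set.ncard_eq_zero] at h₀
    subst h₀
    refine absurd (fun w => ?_) (h.not_isDomSet_pair v v)
    by_cases hw : w = v
    · simp [hw]
    · simpa using hD.2 w hw
  · obtain ⟨a, rfl⟩ := Set.ncard_eq_one.1 h₁
    exact ⟨a, a, by simpa using hD⟩
  · obtain ⟨a, b, -, rfl⟩ := Set.ncard_eq_two.1 h₂
    exact ⟨a, b, hD⟩

/-- If deleting `u` separates `A` from `B` and single vertices dominate `A` and `B`, then
`3`-`γ`-vertex-criticality of `G` makes `G[A ∪ {u}]` a `2`-`γ`-vertex-critical graph. -/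
theorem GammaCritical.induce_union_singleton {V : Type*} [Finite V] {G : SimpleGraph V}
    (hG : GammaCritical G 3) {u a b : V} {A B : Set V}
    (huA : u ∉ A) (huB : u ∉ B) (hdisj : ∀ w ∈ A, w ∉ B)
    (hcov : ∀ w, w = u ∨ w ∈ A ∨ w ∈ B) (hsep : ∀ x ∈ A, ∀ y ∈ B, ¬ G.Adj x y)
    (ha : a ∈ A) (haA : ∀ w ∈ A, w = a ∨ G.Adj a w)
    (hbB : ∀ w ∈ B, w = b ∨ G.Adj b w) :
    GammaCritical (G.induce (A ∪ {u})) 2 := by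
  have hpair : ∀ x y, ¬ ∀ w, (w = x ∨ G.Adj x w) ∨ (w = y ∨ G.Adj y w) := by
    intro x y h
    refine hG.not_isDomSet_pair x y fun w => ?_
    rcases h w with (rfl | h) | (rfl | h) <;> simp [*]
  have hAu : ∀ x, ∃ w, (w = u ∨ w ∈ A) ∧ ¬ (w = x ∨ G.Adj x w) := by
    intro x
    by_contra! h
    refine hpair x b fun w => ?_
    rcases hcov w with hw | hw | hw
    · exact Or.inl (h w (Or.inl hw))
    · exact Or.inl (h w (Or.inr hw))
    · exact Or.inr (hbB w hw)
  refine ⟨domNum_eq_two (x := ⟨a, Or.inl ha⟩) (y := ⟨u, Or.inr rfl⟩) ?_ ?_, ?_⟩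
  · rintro ⟨w, hw | rfl⟩
    · rcases haA w hw with rfl | h
      · simp
      · exact Or.inr ⟨⟨a, Or.inl ha⟩, by simp, h⟩
    · simp
  · rintro ⟨z, hz⟩ hD
    obtain ⟨w, hw, hzw⟩ := hAu z
    rcases hD ⟨w, hw.symm⟩ with h | ⟨x, hx, hxw⟩
    · exact hzw (Or.inl (congrArg Subtype.val h))
    · rw [Set.mem_singleton_iff] at hx
      subst hx
      exact hzw (Or.inr hxw)
  · rintro ⟨v, hv⟩
    suffices h : ∃ z, (z = u ∨ z ∈ A) ∧ z ≠ v ∧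
        ∀ w, (w = u ∨ w ∈ A) → w ≠ v → w = z ∨ G.Adj z w by
      obtain ⟨z, hz, hzv, h⟩ := h
      have hD : IsDomSetAvoiding (G.induce (A ∪ {u})) ⟨v, hv⟩ {⟨z, hz.symm⟩} := by
        refine ⟨fun hmem => hzv (congrArg Subtype.val hmem).symm, ?_⟩
        rintro ⟨w, hw⟩ hwv
        rcases h w hw.symm (fun e => hwv (Subtype.ext e)) with rfl | h
        · simp
        · exact Or.inr ⟨_, rfl, h⟩
      have := domNumDel_le_ncard hD
      rw [Set.ncard_singleton] at this
      omega
    by_cases hvu : v = u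
    · subst hvu
      exact ⟨a, Or.inr ha, fun e => huA (e ▸ ha), fun w hw hwv => haA w (hw.resolve_left hwv)⟩
    have hvA : v ∈ A := hv.resolve_right hvu
    by_cases hA : ∀ w ∈ A, w = v
    · exact ⟨u, Or.inl rfl, Ne.symm hvu, fun w hw hwv =>
        Or.inl (hw.resolve_right fun h => hwv (hA w h))⟩
    push Not at hA
    obtain ⟨w₀, hw₀, hw₀v⟩ := hA
    have hBu : ∀ y, ¬ ((u = y ∨ G.Adj y u) ∧ ∀ w ∈ B, w = y ∨ G.Adj y w) := by
      rintro y ⟨hyu, hyB⟩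
      refine hpair a y fun w => ?_
      rcases hcov w with rfl | hw | hw
      · exact Or.inr hyu
      · exact Or.inl (haA w hw)
      · exact Or.inr (hyB w hw)
    have key : ∀ x y, x ≠ v → x ∉ B → y ∈ B →
        (∀ w, w ≠ v → (w = x ∨ G.Adj x w) ∨ (w = y ∨ G.Adj y w)) →
        ∃ z, (z = u ∨ z ∈ A) ∧ z ≠ v ∧
          ∀ w, (w = u ∨ w ∈ A) → w ≠ v → w = z ∨ G.Adj z w := by
      intro x y hxv hxB hyB h
      refine ⟨x, by grind, hxv, fun w hw hwv => ?_⟩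
      rcases h w hwv with h' | h'
      · exact h'
      rcases hw with rfl | hw
      · by_contra hxw
        refine hBu y ⟨h', fun w' hw' => ?_⟩
        have hxA : x ∈ A := by grind
        rcases h w' (by grind) with (rfl | h'') | h''
        · exact absurd hw' hxB
        · exact absurd h'' (hsep x hxA w' hw')
        · exact h''
      · rcases h' with rfl | h'
        · exact absurd hyB (hdisj w hw)
        · exact absurd h'.symm (hsep w hw y hyB)
    obtain ⟨x, y, hvD, hD⟩ := hG.exists_isDomSetAvoiding_pair v
    have hdom : ∀ w, w ≠ v → (w = x ∨ G.Adj x w) ∨ (w = y ∨ G.Adj y w) := by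
      intro w hw
      have := hD w hw
      simp only [Set.mem_insert_iff, Set.mem_singleton_iff, exists_eq_or_imp, exists_eq_left] at this
      tauto
    have hxv : x ≠ v := by rintro rfl; simp at hvD
    have hyv : y ≠ v := by rintro rfl; simp at hvD
    by_cases hxB : x ∈ B <;> by_cases hyB : y ∈ B
    · have hsymm := fun z hz => fun h : G.Adj z w₀ => hsep w₀ hw₀ z hz h.symm
      rcases hdom w₀ hw₀v with (rfl | h) | (rfl | h)
      · exact absurd hxB (hdisj _ hw₀)
      · exact absurd h (hsymm x hxB)
      · exact absurd hyB (hdisj _ hw₀)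
      · exact absurd h (hsymm y hyB)
    · exact key y x hyv hyB hxB fun w hw => (hdom w hw).symm
    · exact key x y hxv hxB hyB hdom
    · have hsub : ∀ z, z ∉ B → z = u ∨ z ∈ A := by grind
      refine absurd ?_ (hBu u)
      refine ⟨Or.inl rfl, fun w hw => Or.inr ?_⟩
      have hwv : w ≠ v := by rintro rfl; exact hdisj _ hvA hw
      rcases hdom w hwv with (rfl | h) | (rfl | h)
      · exact absurd hw hxB
      · rcases hsub x hxB with rfl | hx
        · exact h
        · exact absurd h (hsep x hx w hw)
      · exact absurd hw hyB
      · rcases hsub y hyB with rfl | hy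
        · exact h
        · exact absurd h (hsep y hy w hw)

/-- if a `3`-`γ`-vertex-critical graph `G` has a cut-vertex `u`, then
`G - u` has exactly two components, and for each component `C` of `G - u`, the
induced subgraph `G[V(C) ∪ {u}]` is `2`-`γ`-vertex-critical. -/
theorem three_gamma_critical_cut_vertex
    {V : Type*} [Fintype V] (G : SimpleGraph V)
    (hcrit : GammaCritical G 3) (u : V)
    (hconn : G.Connected) (hcut : ¬ (G.induce {u}ᶜ).Connected) :
    Nat.card (G.induce {u}ᶜ).ConnectedComponent = 2 ∧
      ∀ C : (G.induce {u}ᶜ).ConnectedComponent,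
        GammaCritical (G.induce (Subtype.val '' C.supp ∪ {u})) 2 := by
  obtain ⟨a, b, huD, hD⟩ := hcrit.exists_isDomSetAvoiding_pair u
  have hau : a ≠ u := by rintro rfl; simp at huD
  have hbu : b ≠ u := by rintro rfl; simp at huD
  set H := G.induce {u}ᶜ with hH
  set Ca := H.connectedComponentMk ⟨a, hau⟩ with hCa
  set Cb := H.connectedComponentMk ⟨b, hbu⟩ with hCb
  have hadj : ∀ {x y : V} (hx : x ≠ u) (hy : y ≠ u), G.Adj x y →
      H.connectedComponentMk ⟨x, hx⟩ = H.connectedComponentMk ⟨y, hy⟩ := fun hx hy h =>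
    ConnectedComponent.sound (Adj.reachable (G := H) h)
  have hdom : ∀ w, w ≠ u → (w = a ∨ G.Adj a w) ∨ (w = b ∨ G.Adj b w) := by
    intro w hw
    have := hD w hw
    simp only [Set.mem_insert_iff, Set.mem_singleton_iff, exists_eq_or_imp, exists_eq_left] at this
    tauto
  have hall : ∀ C, C = Ca ∨ C = Cb := by
    intro C
    induction C using ConnectedComponent.ind with
    | h w =>
      obtain ⟨w, hw⟩ := w
      rcases hdom w hw with (rfl | h) | (rfl | h)
      · exact Or.inl rfl
      · exact Or.inl (hadj hau hw h).symm
      · exact Or.inr rfl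
      · exact Or.inr (hadj hbu hw h).symm
  have hne : Ca ≠ Cb := by
    intro he
    have : Nonempty ({u}ᶜ : Set V) := ⟨⟨a, hau⟩⟩
    refine hcut ⟨fun x y => ConnectedComponent.exact ?_⟩
    rcases hall (H.connectedComponentMk x) with h | h <;>
      rcases hall (H.connectedComponentMk y) with h' | h' <;> simp [h, h', he]
  have hmem : ∀ (C : H.ConnectedComponent) (w : V),
      w ∈ Subtype.val '' C.supp ↔ ∃ hw : w ≠ u, H.connectedComponentMk ⟨w, hw⟩ = C := by
    intro C w
    constructor
    · rintro ⟨⟨w, hw⟩, h, rfl⟩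
      exact ⟨hw, h⟩
    · rintro ⟨hw, h⟩
      exact ⟨⟨w, hw⟩, h, rfl⟩
  have hu : ∀ C : H.ConnectedComponent, u ∉ Subtype.val '' C.supp := by
    intro C h
    exact ((hmem C u).1 h).1 rfl
  have hdisj : ∀ C C' : H.ConnectedComponent, C ≠ C' →
      ∀ w ∈ Subtype.val '' C.supp, w ∉ Subtype.val '' C'.supp := by
    intro C C' hCC' w h h'
    obtain ⟨_, h⟩ := (hmem C w).1 h
    obtain ⟨_, h'⟩ := (hmem C' w).1 h'
    exact hCC' (h.symm.trans h')
  have hsep : ∀ C C' : H.ConnectedComponent, C ≠ C' →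
      ∀ x ∈ Subtype.val '' C.supp, ∀ y ∈ Subtype.val '' C'.supp, ¬ G.Adj x y := by
    intro C C' hCC' x hx y hy hxy
    obtain ⟨hx, h⟩ := (hmem C x).1 hx
    obtain ⟨hy, h'⟩ := (hmem C' y).1 hy
    exact hCC' (h.symm.trans ((hadj hx hy hxy).trans h'))
  have hcov : ∀ w, w = u ∨ w ∈ Subtype.val '' Ca.supp ∨ w ∈ Subtype.val '' Cb.supp := by
    intro w
    by_cases hw : w = u
    · exact Or.inl hw
    · rw [hmem, hmem]
      exact Or.inr ((hall (H.connectedComponentMk ⟨w, hw⟩)).imp (⟨hw, ·⟩) (⟨hw, ·⟩))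
  have haA : ∀ w ∈ Subtype.val '' Ca.supp, w = a ∨ G.Adj a w := by
    intro w hw
    obtain ⟨hwu, h⟩ := (hmem _ w).1 hw
    rcases hdom w hwu with h' | rfl | h'
    · exact h'
    · exact absurd h.symm hne
    · exact absurd (h.symm.trans (hadj hbu hwu h').symm) hne
  have hbB : ∀ w ∈ Subtype.val '' Cb.supp, w = b ∨ G.Adj b w := by
    intro w hw
    obtain ⟨hwu, h⟩ := (hmem _ w).1 hw
    rcases hdom w hwu with (rfl | h') | h'
    · exact absurd h hne
    · exact absurd ((hadj hau hwu h').trans h) hne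
    · exact h'
  constructor
  · rw [Nat.card_eq_two_iff]
    exact ⟨Ca, Cb, hne, Set.eq_univ_of_forall fun C => hall C⟩
  · intro C
    rcases hall C with rfl | rfl
    · exact hcrit.induce_union_singleton (hu _) (hu _) (hdisj _ _ hne) hcov (hsep _ _ hne)
        ((hmem _ a).2 ⟨hau, rfl⟩) haA hbB
    · exact hcrit.induce_union_singleton (hu _) (hu _) (hdisj _ _ hne.symm)
        (fun w => (hcov w).imp_right Or.symm) (hsep _ _ hne.symm)
        ((hmem _ b).2 ⟨hbu, rfl⟩) hbB haA
end

section
/- Let G be a 3-γ-vertex-critical graph and S ⊆ V(G) with |S| = 3. Suppose G − S has at least five odd components and every vertex of S has neighbors in at least three odd components of G − S. Then G − S has no component of even order. -/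
open SimpleGraph

/-- The number of odd components of `G - S` in which the vertex `v` has a neighbor. -/
noncomputable def numOddComponentsWithNeighbor {V : Type*} (G : SimpleGraph V)
    (S : Set V) (v : V) : ℕ :=
  Nat.card {c : (G.induce Sᶜ).ConnectedComponent //
    Odd c.supp.ncard ∧ ∃ w ∈ c.supp, G.Adj v ↑w}

section DominatingPairs

variable {V ι : Type*} {G : SimpleGraph V} {S : Set V} {κ : V → ι}

/-- In a `3`-`γ`-vertex-critical graph, each `G - v` is dominated by two vertices outside the
closed neighbourhood of `v`. -/
theorem GammaCritical.exists_pair [Finite V] (hcrit : GammaCritical G 3) (hV : Nontrivial V)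
    (v : V) : ∃ p q, ¬ G.Adj p v ∧ ¬ G.Adj q v ∧ p ≠ v ∧ q ≠ v ∧
      ∀ u, u ≠ v → u = p ∨ u = q ∨ G.Adj p u ∨ G.Adj q u := by
  obtain ⟨hγ, hdel⟩ := hcrit
  have hne : {n | ∃ D : Set V, IsDomSetAvoiding G v D ∧ D.ncard = n}.Nonempty :=
    ⟨_, {v}ᶜ, ⟨by simp, fun u hu => Or.inl (by simpa using hu)⟩, rfl⟩
  obtain ⟨D, ⟨hvD, hD⟩, hcard⟩ := Nat.sInf_mem hne
  have hlt : D.ncard < 3 := hcard ▸ hdel v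
  have hnadj : ∀ p ∈ D, ¬ G.Adj p v := by
    intro p hp hpv
    have hdom : IsDomSet G D := by
      intro u
      by_cases huv : u = v
      · exact Or.inr ⟨p, hp, huv ▸ hpv⟩
      · exact hD u huv
    have : domNum G ≤ D.ncard := Nat.sInf_le ⟨D, hdom, rfl⟩
    omega
  have hDne : D.Nonempty := by
    obtain ⟨u, hu⟩ := exists_ne v
    rcases hD u hu with h | ⟨w, hw, -⟩
    exacts [⟨u, h⟩, ⟨w, hw⟩]
  obtain ⟨p, q, hpq⟩ : ∃ p q, D = {p, q} := by
    have hpos := (Set.ncard_pos D.toFinite).2 hDne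
    obtain h | h : D.ncard = 1 ∨ D.ncard = 2 := by omega
    · obtain ⟨p, rfl⟩ := Set.ncard_eq_one.1 h
      exact ⟨p, p, by simp⟩
    · obtain ⟨p, q, -, h⟩ := Set.ncard_eq_two.1 h
      exact ⟨p, q, h⟩
  subst hpq
  refine ⟨p, q, hnadj p (by simp), hnadj q (by simp), ?_, ?_, fun u hu => ?_⟩
  · rintro rfl; simp at hvD
  · rintro rfl; simp at hvD
  · simpa [or_assoc] using hD u hu

/-- If `κ` labels the components of `G - S` and at least six labels occur, then any pair
dominating `G - v` meets `S`. -/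
theorem exists_mem_cut_of_pair
    (hκ : ∀ u w, u ∉ S → w ∉ S → G.Adj u w → κ u = κ w)
    (hsix : ∀ k₁ k₂ k₃ k₄ k₅, ∃ u ∉ S, κ u ≠ k₁ ∧ κ u ≠ k₂ ∧ κ u ≠ k₃ ∧ κ u ≠ k₄ ∧ κ u ≠ k₅)
    {v : V} (hpair : ∃ p q, ¬ G.Adj p v ∧ ¬ G.Adj q v ∧ p ≠ v ∧ q ≠ v ∧
      ∀ u, u ≠ v → u = p ∨ u = q ∨ G.Adj p u ∨ G.Adj q u) :
    ∃ s ∈ S, ∃ y, ¬ G.Adj s v ∧ ¬ G.Adj y v ∧ s ≠ v ∧ y ≠ v ∧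
      ∀ u, u ≠ v → u = s ∨ u = y ∨ G.Adj s u ∨ G.Adj y u := by
  obtain ⟨p, q, hp, hq, hpv, hqv, h⟩ := hpair
  by_cases hpS : p ∈ S
  · exact ⟨p, hpS, q, hp, hq, hpv, hqv, h⟩
  by_cases hqS : q ∈ S
  · exact ⟨q, hqS, p, hq, hp, hqv, hpv, fun u hu => by have := h u hu; tauto⟩
  obtain ⟨u, hu, h1, h2, h3, -, -⟩ := hsix (κ p) (κ q) (κ v) (κ v) (κ v)
  rcases h u (fun e => h3 (e ▸ rfl)) with rfl | rfl | h | h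
  · exact absurd rfl h1
  · exact absurd rfl h2
  · exact absurd (hκ p u hpS hu h).symm h1
  · exact absurd (hκ q u hqS hu h).symm h2

/-- If `v ∉ S` is adjacent to the vertices `a`, `b` of a cut `S = {a, b, c}`, then `c` is not
adjacent to `v`, and it dominates everything outside `S` apart from `v` and one component. -/
theorem third_vertex_dominates {a b c : V} (hS : ∀ x, x ∈ S ↔ x = a ∨ x = b ∨ x = c)
    (hκ : ∀ u w, u ∉ S → w ∉ S → G.Adj u w → κ u = κ w)
    (hL : ∀ v, ∃ s ∈ S, ∃ y, ¬ G.Adj s v ∧ ¬ G.Adj y v ∧ s ≠ v ∧ y ≠ v ∧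
      ∀ u, u ≠ v → u = s ∨ u = y ∨ G.Adj s u ∨ G.Adj y u)
    {v : V} (ha : G.Adj a v) (hb : G.Adj b v) :
    ¬ G.Adj c v ∧ ∃ k, ∀ u ∉ S, u ≠ v → κ u ≠ k → G.Adj c u := by
  obtain ⟨s, hs, y, hsv, hyv, -, -, h⟩ := hL v
  obtain rfl : s = c := by
    rcases (hS s).1 hs with rfl | rfl | rfl
    exacts [absurd ha hsv, absurd hb hsv, rfl]
  refine ⟨hsv, κ y, fun u hu huv huk => ?_⟩
  rcases h u huv with rfl | rfl | hsu | hyu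
  · exact absurd hs hu
  · exact absurd rfl huk
  · exact hsu
  · by_cases hyS : y ∈ S
    · rcases (hS y).1 hyS with rfl | rfl | rfl
      exacts [absurd ha hyv, absurd hb hyv, hyu]
    · exact absurd (hκ y u hyS hu hyu).symm huk

/-- In a cut `{a, b, c}` with at least six components, where `a` has neighbours in three of them,
`b` misses vertices of at least two components. -/
theorem not_dominates_all_but_one {a b c : V} (hS : ∀ x, x ∈ S ↔ x = a ∨ x = b ∨ x = c)
    (hκ : ∀ u w, u ∉ S → w ∉ S → G.Adj u w → κ u = κ w)
    (hsix : ∀ k₁ k₂ k₃ k₄ k₅, ∃ u ∉ S, κ u ≠ k₁ ∧ κ u ≠ k₂ ∧ κ u ≠ k₃ ∧ κ u ≠ k₄ ∧ κ u ≠ k₅)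
    (hthree : ∀ k₁ k₂, ∃ u ∉ S, G.Adj a u ∧ κ u ≠ k₁ ∧ κ u ≠ k₂)
    (hL : ∀ v, ∃ s ∈ S, ∃ y, ¬ G.Adj s v ∧ ¬ G.Adj y v ∧ s ≠ v ∧ y ≠ v ∧
      ∀ u, u ≠ v → u = s ∨ u = y ∨ G.Adj s u ∨ G.Adj y u)
    (k : ι) : ¬ ∀ u ∉ S, κ u ≠ k → G.Adj b u := by
  intro hb
  have hthird := fun v => third_vertex_dominates (v := v) hS hκ hL
  obtain ⟨v, hvS, hav, hvk, -⟩ := hthree k k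
  obtain ⟨hcv, l, hl⟩ := hthird v hav (hb v hvS hvk)
  have hvl : κ v ≠ l := by
    obtain ⟨w, hwS, haw, hwk, hwl⟩ := hthree k l
    have hcw := (hthird w haw (hb w hwS hwk)).1
    by_cases hwv : w = v
    · exact hwv ▸ hwl
    · exact absurd (hl w hwS hwv hwl) hcw
  obtain ⟨w, hwS, haw, hwk, hwv⟩ := hthree k (κ v)
  obtain ⟨hcw, m, hm⟩ := hthird w haw (hb w hwS hwk)
  have hvw : v ≠ w := fun e => hwv (e ▸ rfl)
  have hvm : κ v = m := by
    by_contra h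
    exact hcv (hm v hvS hvw h)
  have hc : ∀ u ∉ S, u ≠ v → u ≠ w → G.Adj c u := by
    intro u hu huv huw
    by_cases hul : κ u = l
    · exact hm u hu huw (fun e => hvl (hvm.trans (e.symm.trans hul)))
    · exact hl u hu huv hul
  have ha : ∀ u ∉ S, κ u ≠ k → κ u ≠ κ v → κ u ≠ κ w → ¬ G.Adj a u := fun u hu h1 h2 h3 h =>
    (hthird u h (hb u hu h1)).1
      (hc u hu (fun e => h2 (e ▸ rfl)) (fun e => h3 (e ▸ rfl)))
  obtain ⟨x, hxS, h1, h2, h3, -, -⟩ := hsix k (κ v) (κ w) k k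
  have hbx := hb x hxS h1
  have hcx := hc x hxS (fun e => h2 (e ▸ rfl)) (fun e => h3 (e ▸ rfl))
  obtain ⟨-, m', hm'⟩ := third_vertex_dominates (a := b) (b := c) (c := a)
    (fun x => (hS x).trans (by tauto)) hκ hL hbx hcx
  obtain ⟨u, huS, g1, g2, g3, g4, g5⟩ := hsix k (κ v) (κ w) (κ x) m'
  exact ha u huS g1 g2 g3 (hm' u huS (fun e => g4 (e ▸ rfl)) g5)

/-- The counting step: if every vertex outside `S = {a, b, c}` misses some vertex of `S`, and
each vertex of `S` misses at most one component besides any missed vertex, then with six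
components no component contains two vertices. -/
theorem not_exists_pair_of_missed {a b c : V} {e e' : V}
    (hsix : ∀ k₁ k₂ k₃ k₄ k₅, ∃ u ∉ S, κ u ≠ k₁ ∧ κ u ≠ k₂ ∧ κ u ≠ k₃ ∧ κ u ≠ k₄ ∧ κ u ≠ k₅)
    (hmiss : ∀ u ∉ S, ¬ G.Adj a u ∨ ¬ G.Adj b u ∨ ¬ G.Adj c u)
    (ha : ∀ v ∉ S, ¬ G.Adj a v → ∃ k, ∀ u ∉ S, u ≠ v → κ u ≠ k → G.Adj a u)
    (hb : ∀ v ∉ S, ¬ G.Adj b v → ∃ k, ∀ u ∉ S, u ≠ v → κ u ≠ k → G.Adj b u)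
    (hc : ∀ v ∉ S, ¬ G.Adj c v → ∃ k, ∀ u ∉ S, u ≠ v → κ u ≠ k → G.Adj c u)
    (heS : e ∉ S) (heS' : e' ∉ S) (hne : e ≠ e') (hee : κ e = κ e') (hce : ¬ G.Adj c e) :
    False := by
  have two : ∀ s, (∀ v ∉ S, ¬ G.Adj s v → ∃ k, ∀ u ∉ S, u ≠ v → κ u ≠ k → G.Adj s u) →
      ∃ k l, ∀ u ∉ S, κ u ≠ k → κ u ≠ l → G.Adj s u := by
    intro s hs
    by_cases h : ∃ v ∉ S, ¬ G.Adj s v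
    · obtain ⟨v, hv, hsv⟩ := h
      obtain ⟨k, hk⟩ := hs v hv hsv
      exact ⟨κ v, k, fun u hu h1 h2 => hk u hu (fun e => h1 (e ▸ rfl)) h2⟩
    · push Not at h
      exact ⟨κ e, κ e, fun u hu _ _ => h u hu⟩
  obtain ⟨k₁, k₂, h12⟩ := two a ha
  obtain ⟨k₃, k₄, h34⟩ := two b hb
  obtain ⟨k, hk⟩ := hc e heS hce
  have hu_ne : ∀ {u w : V}, κ u ≠ κ w → u ≠ w := fun h e => h (e ▸ rfl)
  have hce' : ¬ G.Adj c e' → False := by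
    intro h
    obtain ⟨l, hl⟩ := hc e' heS' h
    obtain ⟨u, hu, g1, g2, g3, g4, g5⟩ := hsix k₁ k₂ k₃ k₄ (κ e)
    have hcu : ¬ G.Adj c u := by
      have := hmiss u hu
      have := h12 u hu g1 g2
      have := h34 u hu g3 g4
      tauto
    have hul : κ u = l := by
      by_contra h'
      exact hcu (hl u hu (hu_ne (hee ▸ g5)) h')
    exact hce (hl e heS hne (fun h' => g5 (hul.trans h'.symm)))
  rcases hmiss e' heS' with h | h | h
  · obtain ⟨l, hl⟩ := ha e' heS' h
    obtain ⟨u, hu, g1, g2, g3, g4, g5⟩ := hsix l k k₃ k₄ (κ e)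
    have := hmiss u hu
    have := hl u hu (hu_ne (hee ▸ g5)) g1
    have := h34 u hu g3 g4
    have := hk u hu (hu_ne g5) g2
    tauto
  · obtain ⟨l, hl⟩ := hb e' heS' h
    obtain ⟨u, hu, g1, g2, g3, g4, g5⟩ := hsix k₁ k₂ l k (κ e)
    have := hmiss u hu
    have := h12 u hu g1 g2
    have := hl u hu (hu_ne (hee ▸ g5)) g3
    have := hk u hu (hu_ne g5) g4
    tauto
  · exact hce' h

/-- With at least six components, each vertex of the three-element cut having neighbours in three
of them, no component has two vertices. -/
theorem component_subsingleton {a b c : V} (hS : ∀ x, x ∈ S ↔ x = a ∨ x = b ∨ x = c)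
    (hκ : ∀ u w, u ∉ S → w ∉ S → G.Adj u w → κ u = κ w)
    (hsix : ∀ k₁ k₂ k₃ k₄ k₅, ∃ u ∉ S, κ u ≠ k₁ ∧ κ u ≠ k₂ ∧ κ u ≠ k₃ ∧ κ u ≠ k₄ ∧ κ u ≠ k₅)
    (hthree : ∀ s ∈ S, ∀ k₁ k₂, ∃ u ∉ S, G.Adj s u ∧ κ u ≠ k₁ ∧ κ u ≠ k₂)
    (hL : ∀ v, ∃ s ∈ S, ∃ y, ¬ G.Adj s v ∧ ¬ G.Adj y v ∧ s ≠ v ∧ y ≠ v ∧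
      ∀ u, u ≠ v → u = s ∨ u = y ∨ G.Adj s u ∨ G.Adj y u)
    {e e' : V} (heS : e ∉ S) (heS' : e' ∉ S) (hee : κ e = κ e') : e = e' := by
  by_contra hne
  have hSacb : ∀ x, x ∈ S ↔ x = a ∨ x = c ∨ x = b := fun x => (hS x).trans (by tauto)
  have hSbac : ∀ x, x ∈ S ↔ x = b ∨ x = a ∨ x = c := fun x => (hS x).trans (by tauto)
  have hSbca : ∀ x, x ∈ S ↔ x = b ∨ x = c ∨ x = a := fun x => (hS x).trans (by tauto)
  have hScab : ∀ x, x ∈ S ↔ x = c ∨ x = a ∨ x = b := fun x => (hS x).trans (by tauto)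
  have hScba : ∀ x, x ∈ S ↔ x = c ∨ x = b ∨ x = a := fun x => (hS x).trans (by tauto)
  have cover : ∀ a b c : V, (∀ x, x ∈ S ↔ x = a ∨ x = b ∨ x = c) →
      ∀ u ∉ S, G.Adj b u ∨ G.Adj c u := by
    intro a b c hS u hu
    obtain ⟨s, hs, y, -, -, hsa, hya, h⟩ := hL a
    have hyS : y ∈ S := by
      by_contra hyS
      have hdom : ∀ u ∉ S, κ u ≠ κ y → G.Adj s u := by
        intro u hu huy
        rcases h u (fun e => hu ((hS u).2 (Or.inl e))) with rfl | rfl | h | h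
        · exact absurd hs hu
        · exact absurd rfl huy
        · exact h
        · exact absurd (hκ y u hyS hu h).symm huy
      have ha := hthree a ((hS a).2 (Or.inl rfl))
      rcases (hS s).1 hs with rfl | rfl | rfl
      · exact hsa rfl
      · exact not_dominates_all_but_one hS hκ hsix ha hL _ hdom
      · exact not_dominates_all_but_one (a := a) (b := s) (c := b)
          (fun x => (hS x).trans (by tauto)) hκ hsix ha hL _ hdom
    have hsu : u ≠ s := fun e => hu (e ▸ hs)
    have hyu : u ≠ y := fun e => hu (e ▸ hyS)
    have hua := h u (fun e => hu ((hS u).2 (Or.inl e)))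
    rcases (hS s).1 hs with rfl | rfl | rfl <;> rcases (hS y).1 hyS with rfl | rfl | rfl <;> tauto
  have cover_a := cover a b c hS
  have cover_b := cover b a c hSbac
  have cover_c := cover c a b hScab
  have ha : ∀ v ∉ S, ¬ G.Adj a v → ∃ k, ∀ u ∉ S, u ≠ v → κ u ≠ k → G.Adj a u := fun v hv h =>
    (third_vertex_dominates hSbca hκ hL ((cover_c v hv).resolve_left h)
      ((cover_b v hv).resolve_left h)).2
  have hb : ∀ v ∉ S, ¬ G.Adj b v → ∃ k, ∀ u ∉ S, u ≠ v → κ u ≠ k → G.Adj b u := fun v hv h =>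
    (third_vertex_dominates hSacb hκ hL ((cover_c v hv).resolve_right h)
      ((cover_a v hv).resolve_left h)).2
  have hc : ∀ v ∉ S, ¬ G.Adj c v → ∃ k, ∀ u ∉ S, u ≠ v → κ u ≠ k → G.Adj c u := fun v hv h =>
    (third_vertex_dominates hS hκ hL ((cover_b v hv).resolve_right h)
      ((cover_a v hv).resolve_right h)).2
  have hmiss : ∀ u ∉ S, ¬ G.Adj a u ∨ ¬ G.Adj b u ∨ ¬ G.Adj c u := by
    intro u hu
    by_contra! h
    exact (third_vertex_dominates hS hκ hL h.1 h.2.1).1 h.2.2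
  rcases hmiss e heS with h | h | h
  · exact not_exists_pair_of_missed hsix (fun u hu => by have := hmiss u hu; tauto)
      hb hc ha heS heS' hne hee h
  · exact not_exists_pair_of_missed hsix (fun u hu => by have := hmiss u hu; tauto)
      ha hc hb heS heS' hne hee h
  · exact not_exists_pair_of_missed hsix hmiss ha hb hc heS heS' hne hee h

end DominatingPairs

/-- let `G` be `3`-`γ`-vertex-critical and `S` a set of three vertices such
that `G - S` has at least five odd components and every vertex of `S` has neighbors in at
least three odd components of `G - S`. Then `G - S` has no component of even order. -/
theorem three_cut_no_even_component
    {V : Type*} [Fintype V] (G : SimpleGraph V)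
    (hcrit : GammaCritical G 3) (S : Set V) (hS : S.ncard = 3)
    (hodd : 5 ≤ numOddComponents G S)
    (hadj : ∀ v ∈ S, 3 ≤ numOddComponentsWithNeighbor G S v) :
    ∀ C : (G.induce Sᶜ).ConnectedComponent, ¬ Even C.supp.ncard := by
  classical
  intro C hC
  obtain ⟨a, b, c, hab, -, -, habc⟩ := Set.ncard_eq_three.1 hS
  let κ : V → (G.induce Sᶜ).ConnectedComponent := fun u =>
    if h : u ∈ Sᶜ then (G.induce Sᶜ).connectedComponentMk ⟨u, h⟩ else C
  have κ_mk : ∀ u : ↥Sᶜ, κ u = (G.induce Sᶜ).connectedComponentMk u := fun u => dif_pos u.2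
  have hκ : ∀ u w, u ∉ S → w ∉ S → G.Adj u w → κ u = κ w := by
    intro u w hu hw h
    rw [κ_mk ⟨u, hu⟩, κ_mk ⟨w, hw⟩]
    exact SimpleGraph.ConnectedComponent.sound (SimpleGraph.Adj.reachable (G := G.induce Sᶜ) h)
  have hsix : ∀ k₁ k₂ k₃ k₄ k₅,
      ∃ u ∉ S, κ u ≠ k₁ ∧ κ u ≠ k₂ ∧ κ u ≠ k₃ ∧ κ u ≠ k₄ ∧ κ u ≠ k₅ := by
    intro k₁ k₂ k₃ k₄ k₅
    by_contra! h
    have hsub : insert C {K : (G.induce Sᶜ).ConnectedComponent | Odd K.supp.ncard} ⊆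
        (({k₁, k₂, k₃, k₄, k₅} : Finset _) : Set (G.induce Sᶜ).ConnectedComponent) := by
      intro K _
      induction K using SimpleGraph.ConnectedComponent.ind with | _ u =>
      have := h u u.2
      rw [κ_mk] at this
      simp only [Finset.coe_insert, Finset.coe_singleton, Set.mem_insert_iff,
        Set.mem_singleton_iff]
      tauto
    have hle := Set.ncard_le_ncard hsub
    rw [Set.ncard_insert_of_notMem (by simpa using hC), Set.ncard_coe_finset] at hle
    have h5 : 5 ≤ {K : (G.induce Sᶜ).ConnectedComponent | Odd K.supp.ncard}.ncard := hodd
    have := hle.trans Finset.card_le_five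
    omega
  have hthree : ∀ s ∈ S, ∀ k₁ k₂, ∃ u ∉ S, G.Adj s u ∧ κ u ≠ k₁ ∧ κ u ≠ k₂ := by
    intro s hs k₁ k₂
    by_contra! h
    have hsub : {K : (G.induce Sᶜ).ConnectedComponent |
        Odd K.supp.ncard ∧ ∃ w ∈ K.supp, G.Adj s ↑w} ⊆
        (({k₁, k₂} : Finset _) : Set (G.induce Sᶜ).ConnectedComponent) := by
      rintro K ⟨-, w, rfl, hsw⟩
      have := h w w.2 hsw
      rw [κ_mk] at this
      simp only [Finset.coe_insert, Finset.coe_singleton, Set.mem_insert_iff,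
        Set.mem_singleton_iff]
      tauto
    have hle := Set.ncard_le_ncard hsub
    rw [Set.ncard_coe_finset] at hle
    have h3 : 3 ≤ {K : (G.induce Sᶜ).ConnectedComponent |
        Odd K.supp.ncard ∧ ∃ w ∈ K.supp, G.Adj s ↑w}.ncard := hadj s hs
    have := hle.trans Finset.card_le_two
    omega
  have hL := fun v => exists_mem_cut_of_pair hκ hsix (hcrit.exists_pair ⟨a, b, hab⟩ v)
  have hone : 1 < C.supp.ncard := by
    have := (Set.ncard_pos C.supp.toFinite).2 C.nonempty_supp
    obtain ⟨m, hm⟩ := hC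
    omega
  obtain ⟨e, he, e', he', hne⟩ := (Set.one_lt_ncard C.supp.toFinite).1 hone
  refine hne (Subtype.ext (component_subsingleton (S := S) (κ := κ) (a := a) (b := b) (c := c)
    (fun x => by simp [habc]) hκ hsix hthree hL e.2 e'.2 ?_))
  rw [κ_mk, κ_mk]
  exact Eq.trans he (Eq.symm he')
end
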